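/- Let V be a finite-dimensional real vector space and L a one-dimensional complex subspace of ℂ ⊗[ℝ] V such that the only v ∈ V with 1⊗v ∈ L is v = 0. Then there exist a unique two-dimensional real linear subspace P ⊆ V and a unique real-linear map j : P → P with j ∘ j = -id such that L = { 1⊗v - i·(1⊗(j v)) : v ∈ P }. -/

import Mathlib

open TensorProduct

section SatoHelpers

variable {V : Type*} [AddCommGroup V] [Module ℝ V]

/-- Real part on the complexification. -/
noncomputable def satoRe (V : Type*) [AddCommGroup V] [Module ℝ V] : ℂ ⊗[ℝ] V →ₗ[ℝ] V :=
  (TensorProduct.lid ℝ V).toLinearMap ∘ₗ LinearMap.rTensor V Complex.reLm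

/-- Imaginary part on the complexification. -/
noncomputable def satoIm (V : Type*) [AddCommGroup V] [Module ℝ V] : ℂ ⊗[ℝ] V →ₗ[ℝ] V :=
  (TensorProduct.lid ℝ V).toLinearMap ∘ₗ LinearMap.rTensor V Complex.imLm

theorem satoRe_tmul (c : ℂ) (v : V) : satoRe V (c ⊗ₜ[ℝ] v) = c.re • v := by
  simp [satoRe]

theorem satoIm_tmul (c : ℂ) (v : V) : satoIm V (c ⊗ₜ[ℝ] v) = c.im • v := by
  simp [satoIm]

theorem satoRe_I (z : ℂ ⊗[ℝ] V) : satoRe V (Complex.I • z) = - satoIm V z := by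
  induction z using TensorProduct.induction_on with
  | zero => simp
  | tmul c v => simp [TensorProduct.smul_tmul', satoRe_tmul, satoIm_tmul]
  | add x y hx hy => rw [smul_add, map_add, map_add, hx, hy]; abel

theorem sato_decomp (z : ℂ ⊗[ℝ] V) :
    z = (1 : ℂ) ⊗ₜ[ℝ] (satoRe V z) + Complex.I • ((1 : ℂ) ⊗ₜ[ℝ] (satoIm V z)) := by
  induction z using TensorProduct.induction_on with
  | zero => simp
  | tmul c v =>
    rw [satoRe_tmul, satoIm_tmul, TensorProduct.smul_tmul', ← TensorProduct.smul_tmul,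
      ← TensorProduct.smul_tmul, ← TensorProduct.add_tmul]
    congr 1
    apply Complex.ext <;> simp
  | add x y hx hy =>
    rw [map_add, map_add, TensorProduct.tmul_add, TensorProduct.tmul_add, smul_add]
    nth_rewrite 1 [hx, hy]
    abel

theorem satoRe_sato (v w : V) :
    satoRe V ((1 : ℂ) ⊗ₜ[ℝ] v - Complex.I • ((1 : ℂ) ⊗ₜ[ℝ] w)) = v := by
  rw [map_sub, satoRe_I, satoRe_tmul, satoIm_tmul]; simp

theorem satoIm_sato (v w : V) :
    satoIm V ((1 : ℂ) ⊗ₜ[ℝ] v - Complex.I • ((1 : ℂ) ⊗ₜ[ℝ] w)) = -w := by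
  rw [map_sub, TensorProduct.smul_tmul', satoIm_tmul, satoIm_tmul]; simp

theorem satoRe_inj (L : Submodule ℂ (ℂ ⊗[ℝ] V))
    (hreal : ∀ v : V, (1 : ℂ) ⊗ₜ[ℝ] v ∈ L → v = 0) (z : ℂ ⊗[ℝ] V) (hz : z ∈ L)
    (h : satoRe V z = 0) : z = 0 := by
  have h1 := sato_decomp z
  rw [h, TensorProduct.tmul_zero, zero_add] at h1
  have h2 : (1 : ℂ) ⊗ₜ[ℝ] (satoIm V z) ∈ L := by
    have h3 := L.smul_mem (-Complex.I) hz
    rw [h1, smul_smul] at h3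
    simpa using h3
  rw [hreal _ h2] at h1
  simpa using h1

end SatoHelpers

/-- A complex line in the complexification of a finite-dimensional real vector
space containing no nonzero real vector is the set of Sato vectors
`1⊗v - i·(1⊗(j v))`, `v ∈ P`, for a unique 2-plane `P ⊆ V` with a unique
complex structure `j` on `P`. -/
theorem sato_space_parameterization
    (V : Type*) [AddCommGroup V] [Module ℝ V] [FiniteDimensional ℝ V]
    (L : Submodule ℂ (ℂ ⊗[ℝ] V)) (hL : Module.finrank ℂ L = 1)
    (hreal : ∀ v : V, (1 : ℂ) ⊗ₜ[ℝ] v ∈ L → v = 0) :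
    ∃ (P : Submodule ℝ V) (j : P →ₗ[ℝ] P),
      Module.finrank ℝ P = 2 ∧
      j ∘ₗ j = -LinearMap.id ∧
      (L : Set (ℂ ⊗[ℝ] V)) =
        {z | ∃ v : P, z = (1 : ℂ) ⊗ₜ[ℝ] (v : V)
          - Complex.I • ((1 : ℂ) ⊗ₜ[ℝ] ((j v : P) : V))} ∧
      ∀ (P' : Submodule ℝ V) (j' : P' →ₗ[ℝ] P'),
        Module.finrank ℝ P' = 2 →
        j' ∘ₗ j' = -LinearMap.id →
        (L : Set (ℂ ⊗[ℝ] V)) =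
          {z | ∃ v : P', z = (1 : ℂ) ⊗ₜ[ℝ] (v : V)
            - Complex.I • ((1 : ℂ) ⊗ₜ[ℝ] ((j' v : P') : V))} →
        P' = P ∧ ∀ (v : V) (h' : v ∈ P') (h : v ∈ P),
          ((j' ⟨v, h'⟩ : P') : V) = ((j ⟨v, h⟩ : P) : V) := by
  have hinj : Function.Injective ((satoRe V).domRestrict (L.restrictScalars ℝ)) := by
    rw [injective_iff_map_eq_zero]
    intro z hz
    exact Subtype.ext (satoRe_inj L hreal z.1 z.2 hz)
  let P : Submodule ℝ V := LinearMap.range ((satoRe V).domRestrict (L.restrictScalars ℝ))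
  let e : L.restrictScalars ℝ ≃ₗ[ℝ] P := LinearEquiv.ofInjective _ hinj
  have he : ∀ z, (e z : V) = satoRe V z.1 := fun z => rfl
  let m : L.restrictScalars ℝ →ₗ[ℝ] L.restrictScalars ℝ :=
    { toFun := fun z => ⟨Complex.I • z.1, L.smul_mem _ z.2⟩
      map_add' := fun x y => Subtype.ext (smul_add _ _ _)
      map_smul' := fun c x => Subtype.ext (smul_comm Complex.I c x.1) }
  have hm : ∀ z, (m z).1 = Complex.I • z.1 := fun z => rfl
  let j : P →ₗ[ℝ] P := e.toLinearMap ∘ₗ m ∘ₗ e.symm.toLinearMap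
  have hj : ∀ z, j (e z) = e (m z) := fun z => by simp [j]
  have hjim : ∀ z, ((j (e z) : P) : V) = - satoIm V z.1 := fun z => by
    rw [hj, he, hm, satoRe_I]
  have hz : ∀ z, (1 : ℂ) ⊗ₜ[ℝ] ((e z : P) : V)
      - Complex.I • ((1 : ℂ) ⊗ₜ[ℝ] ((j (e z) : P) : V)) = z.1 := fun z => by
    rw [hjim, he, TensorProduct.tmul_neg, smul_neg, sub_neg_eq_add]
    exact (sato_decomp z.1).symm
  refine ⟨P, j, ?_, ?_, ?_, ?_⟩
  · rw [← e.finrank_eq]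
    have h := finrank_real_of_complex L
    rw [hL] at h
    exact h
  · ext v
    obtain ⟨z, rfl⟩ := e.surjective v
    have : m (m z) = -z := Subtype.ext (by
      rw [hm, hm, smul_smul, Complex.I_mul_I]; simp)
    simp only [LinearMap.comp_apply, hj, this, map_neg]
    simp
  · ext z
    constructor
    · intro h
      exact ⟨e ⟨z, h⟩, (hz ⟨z, h⟩).symm⟩
    · rintro ⟨v, rfl⟩
      obtain ⟨z, rfl⟩ := e.surjective v
      rw [hz]
      exact z.2
  · intro P' j' _ _ hL'
    have hmem : ∀ v : P', (1 : ℂ) ⊗ₜ[ℝ] (v : V)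
            - Complex.I • ((1 : ℂ) ⊗ₜ[ℝ] ((j' v : P') : V)) ∈ L := fun v => by
      rw [← SetLike.mem_coe, hL']
      exact ⟨v, rfl⟩
    refine ⟨?_, ?_⟩
    · ext v
      constructor
      · intro hv
        exact ⟨⟨_, hmem ⟨v, hv⟩⟩, satoRe_sato _ _⟩
      · rintro ⟨z, rfl⟩
        have h := z.2
        change z.1 ∈ (L : Set (ℂ ⊗[ℝ] V)) at h
        rw [hL'] at h
        obtain ⟨v, hv⟩ := h
        change satoRe V z.1 ∈ P'
        rw [hv, satoRe_sato]
        exact v.2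
    · intro v h' h
      have h1 : (⟨v, h⟩ : P) = e ⟨_, hmem ⟨v, h'⟩⟩ :=
        Subtype.ext (by rw [he]; exact (satoRe_sato _ _).symm)
      rw [h1, hjim, satoIm_sato, neg_neg]
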